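/- (Claim 5.5) Let 0 < σ < 1 satisfy 1 + σ^{−2} ≤ 3 (i.e., σ ≥ 1/√2), and let f : {−1,1}ⁿ → [−1,1]. Then Δ_n(T_σ f) ≤ (max_{1≤i≤n} Inf_i(f))^{(1−σ²)/(2σ²)}. -/

import Mathlib

noncomputable section
namespace DMN

/-- The real sign of a boolean bit: `true ↦ 1`, `false ↦ -1`. -/
def sgn (b : Bool) : ℝ := if b then 1 else -1

/-- The character `χ_S(x) = ∏_{i ∈ S} x_i` on the discrete cube. -/
def chi {n : ℕ} (S : Finset (Fin n)) (x : Fin n → Bool) : ℝ := ∏ i ∈ S, sgn (x i)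

/-- Expectation over the uniform measure on `{-1,1}^n`. -/
def cubeE {n : ℕ} (f : (Fin n → Bool) → ℝ) : ℝ := (∑ x, f x) / 2 ^ n

/-- Fourier coefficient `f̂(S) = E[f · χ_S]`. -/
def fhat {n : ℕ} (f : (Fin n → Bool) → ℝ) (S : Finset (Fin n)) : ℝ :=
  cubeE fun x => f x * chi S x

/-- `Δ₁(g) = E|g - E g|³` for `g : {-1,1} → ℝ` (uniform measure on one bit). -/
def Delta1Cube (g : Bool → ℝ) : ℝ :=
  (∑ b : Bool, |g b - (∑ b' : Bool, g b') / 2| ^ 3) / 2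

/-- The recursively defined functional `Δ_n` on the discrete cube:
`Δ_n(f) = E_{X_n}[Δ_{n-1}(f_{X_n})] + Δ₁(E[f_{X_n} | X_n])`, with `Δ_0 = 0`. -/
def DeltaCube : (n : ℕ) → ((Fin n → Bool) → ℝ) → ℝ
  | 0, _ => 0
  | n + 1, f =>
      (∑ b : Bool, DeltaCube n fun z => f (Fin.snoc z b)) / 2 +
        Delta1Cube fun b => cubeE fun z => f (Fin.snoc z b)

/-- The noise operator `T_σ`: `(T_σ f)(x) = E_{y ∼_σ x}[f(y)]`, where each coordinate
`y_i` independently equals `x_i` with probability `(1+σ)/2` and `-x_i` otherwise. -/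
def noiseOp {n : ℕ} (σ : ℝ) (f : (Fin n → Bool) → ℝ) : (Fin n → Bool) → ℝ :=
  fun x => ∑ y, f y * ∏ i, (if y i = x i then (1 + σ) / 2 else (1 - σ) / 2)

/-- The influence `Inf_i(f) = Σ_{S ∋ i} f̂(S)²`. -/
def influence {n : ℕ} (f : (Fin n → Bool) → ℝ) (i : Fin n) : ℝ :=
  ∑ S ∈ Finset.univ.powerset.filter (fun S => i ∈ S), fhat f S ^ 2

/-- The product noise operator with correlation `ρ i` in the `i`-th coordinate. -/
def prodNoise {n : ℕ} (ρ : Fin n → ℝ) (f : (Fin n → Bool) → ℝ) : (Fin n → Bool) → ℝ :=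
  fun x => ∑ y, f y * ∏ i, (if y i = x i then (1 + ρ i) / 2 else (1 - ρ i) / 2)

lemma prodNoise_linear {n : ℕ} (ρ : Fin n → ℝ) (f g : (Fin n → Bool) → ℝ) (a b : ℝ)
    (x : Fin n → Bool) :
    prodNoise ρ (fun y => a * f y + b * g y) x = a * prodNoise ρ f x + b * prodNoise ρ g x := by
  simp only [prodNoise, Finset.mul_sum, ← Finset.sum_add_distrib]
  exact Finset.sum_congr rfl fun y _ => by ring

lemma sum_cube_succ {n : ℕ} (g : (Fin (n + 1) → Bool) → ℝ) :
    ∑ x, g x = ∑ b : Bool, ∑ z : Fin n → Bool, g (Fin.snoc z b) := by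
  rw [← (Fin.snocEquiv fun _ : Fin (n + 1) => Bool).sum_comp, Fintype.sum_prod_type]
  rfl

lemma cubeE_succ {n : ℕ} (g : (Fin (n + 1) → Bool) → ℝ) :
    cubeE g = (∑ b : Bool, cubeE fun z : Fin n → Bool => g (Fin.snoc z b)) / 2 := by
  simp only [cubeE, sum_cube_succ g, ← Finset.sum_div]
  rw [div_div, pow_succ]

lemma prodNoise_snoc {n : ℕ} (ρ : Fin (n + 1) → ℝ) (g : (Fin (n + 1) → Bool) → ℝ)
    (z : Fin n → Bool) (b : Bool) :
    prodNoise ρ g (Fin.snoc z b) =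
      (1 + ρ (Fin.last n)) / 2 *
          prodNoise (fun i => ρ i.castSucc) (fun w => g (Fin.snoc w b)) z +
        (1 - ρ (Fin.last n)) / 2 *
          prodNoise (fun i => ρ i.castSucc) (fun w => g (Fin.snoc w (!b))) z := by
  simp only [prodNoise, sum_cube_succ (n := n), Fin.prod_univ_castSucc, Fin.snoc_castSucc,
    Fin.snoc_last, Finset.mul_sum]
  cases b <;> simp
  · rw [add_comm]
    congr 1 <;> exact Finset.sum_congr rfl fun y _ => by ring
  · congr 1 <;> exact Finset.sum_congr rfl fun y _ => by ring

lemma prodNoise_comp {n : ℕ} (ρ τ : Fin n → ℝ) (f : (Fin n → Bool) → ℝ) :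
    prodNoise ρ (prodNoise τ f) = prodNoise (fun i => ρ i * τ i) f := by
  funext x
  simp only [prodNoise, Finset.sum_mul]
  rw [Finset.sum_comm]
  refine Finset.sum_congr rfl fun y _ => ?_
  simp only [mul_assoc, ← Finset.mul_sum, ← Finset.prod_mul_distrib]
  congr 1
  have h := Finset.prod_univ_sum (fun _ : Fin n => (Finset.univ : Finset Bool))
    (fun i c => (if y i = c then (1 + τ i) / 2 else (1 - τ i) / 2) *
      (if c = x i then (1 + ρ i) / 2 else (1 - ρ i) / 2))
  rw [Fintype.piFinset_univ] at h
  rw [← h]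
  refine Finset.prod_congr rfl fun i _ => ?_
  cases x i <;> cases y i <;> simp <;> ring

lemma prodNoise_one {n : ℕ} (f : (Fin n → Bool) → ℝ) : prodNoise (fun _ => 1) f = f := by
  funext x
  have h (y : Fin n → Bool) :
      (∏ i, if y i = x i then ((1 : ℝ) + 1) / 2 else (1 - 1) / 2) = if y = x then 1 else 0 := by
    simp [Finset.prod_ite_zero, funext_iff]
  simp only [prodNoise, h]
  simp

lemma prodNoise_zero {n : ℕ} (f : (Fin n → Bool) → ℝ) (x : Fin n → Bool) :
    prodNoise (fun _ => 0) f x = cubeE f := by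
  simp [prodNoise, cubeE, Finset.sum_mul, div_eq_mul_inv]

lemma prodNoise_eq_sum_fhat {n : ℕ} (ρ : Fin n → ℝ) (f : (Fin n → Bool) → ℝ)
    (x : Fin n → Bool) :
    prodNoise ρ f x = ∑ S : Finset (Fin n), (∏ i ∈ S, ρ i) * fhat f S * chi S x := by
  have h (y : Fin n → Bool) : (∏ i, if y i = x i then (1 + ρ i) / 2 else (1 - ρ i) / 2) =
      (∑ S : Finset (Fin n), (∏ i ∈ S, ρ i) * chi S y * chi S x) / 2 ^ n := by
    have h1 : (∏ i, if y i = x i then (1 + ρ i) / 2 else (1 - ρ i) / 2) =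
        ∏ i, (1 + ρ i * sgn (y i) * sgn (x i)) / 2 :=
      Finset.prod_congr rfl fun i _ => by
        cases x i <;> cases y i <;> simp [sgn] <;> ring
    rw [h1, Finset.prod_div_distrib, Finset.prod_one_add]
    simp [chi, Finset.prod_mul_distrib]
  simp only [prodNoise, h, fhat, cubeE, Finset.sum_div, Finset.mul_sum, Finset.sum_mul]
  rw [Finset.sum_comm]
  exact Finset.sum_congr rfl fun S _ => Finset.sum_congr rfl fun y _ => by ring

lemma cubeE_mul_prodNoise {n : ℕ} (ρ : Fin n → ℝ) (f : (Fin n → Bool) → ℝ) :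
    (cubeE fun x => f x * prodNoise ρ f x) =
      ∑ S : Finset (Fin n), (∏ i ∈ S, ρ i) * fhat f S ^ 2 := by
  simp only [cubeE, prodNoise_eq_sum_fhat, Finset.mul_sum]
  rw [Finset.sum_comm, Finset.sum_div]
  refine Finset.sum_congr rfl fun S _ => ?_
  rw [sq]
  nth_rw 3 [fhat]
  rw [cubeE, ← mul_div_assoc, ← mul_div_assoc, Finset.mul_sum, Finset.mul_sum]
  exact congrArg (· / _) (Finset.sum_congr rfl fun x _ => by ring)

lemma cubeE_prodNoise_mul_prodNoise {n : ℕ} (ρ τ : Fin n → ℝ) (f : (Fin n → Bool) → ℝ) :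
    (cubeE fun x => prodNoise ρ f x * prodNoise τ f x) =
      ∑ S : Finset (Fin n), (∏ i ∈ S, ρ i * τ i) * fhat f S ^ 2 := by
  rw [← cubeE_mul_prodNoise, ← prodNoise_comp]
  simp only [cubeE]
  congr 1
  generalize prodNoise τ f = g
  simp only [prodNoise, Finset.sum_mul, Finset.mul_sum]
  rw [Finset.sum_comm]
  refine Finset.sum_congr rfl fun x _ => Finset.sum_congr rfl fun y _ => ?_
  simp only [eq_comm]
  ring

lemma abs_prodNoise_le_one {n : ℕ} {ρ : Fin n → ℝ} (hρ : ∀ i, |ρ i| ≤ 1)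
    {f : (Fin n → Bool) → ℝ} (hf : ∀ x, |f x| ≤ 1) (x : Fin n → Bool) :
    |prodNoise ρ f x| ≤ 1 := by
  have hK (y : Fin n → Bool) (i : Fin n) :
      0 ≤ if y i = x i then (1 + ρ i) / 2 else (1 - ρ i) / 2 := by
    have := abs_le.1 (hρ i)
    split_ifs <;> linarith
  have hsum : ∑ y : Fin n → Bool, ∏ i, (if y i = x i then (1 + ρ i) / 2 else (1 - ρ i) / 2)
      = 1 := by
    have h := Finset.prod_univ_sum (fun _ : Fin n => (Finset.univ : Finset Bool))
      (fun i c => if c = x i then (1 + ρ i) / 2 else (1 - ρ i) / 2)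
    rw [Fintype.piFinset_univ] at h
    rw [← h]
    refine Finset.prod_eq_one fun i _ => ?_
    cases x i <;> simp <;> ring
  rw [← hsum]
  refine (Finset.abs_sum_le_sum_abs _ _).trans (Finset.sum_le_sum fun y _ => ?_)
  rw [abs_mul, abs_of_nonneg (Finset.prod_nonneg fun i _ => hK y i)]
  exact mul_le_of_le_one_left (Finset.prod_nonneg fun i _ => hK y i) (hf y)

lemma one_add_rpow_add_one_sub_rpow_le {q y : ℝ} (hq2 : 2 ≤ q) (hq3 : q ≤ 3) (hy0 : 0 ≤ y)
    (hy1 : y ≤ 1) : (1 + y) ^ q + (1 - y) ^ q ≤ 2 + q * (q - 1) * y ^ 2 := by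
  have hd (p x : ℝ) (hp : 1 ≤ p) :
      HasDerivAt (fun x : ℝ => (1 + x) ^ p) (p * (1 + x) ^ (p - 1)) x := by
    simpa using ((hasDerivAt_id x).const_add 1).rpow_const (p := p) (Or.inr hp)
  have hd' (p x : ℝ) (hp : 1 ≤ p) :
      HasDerivAt (fun x : ℝ => (1 - x) ^ p) (-(p * (1 - x) ^ (p - 1))) x := by
    simpa using ((hasDerivAt_id x).const_sub 1).rpow_const (p := p) (Or.inr hp)
  have h1 : MonotoneOn (fun x : ℝ => 2 * (q - 1) * x - (1 + x) ^ (q - 1) + (1 - x) ^ (q - 1))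
      (Set.Icc 0 1) := by
    have hD (x : ℝ) := (((hasDerivAt_id x).const_mul (2 * (q - 1))).sub
      (hd (q - 1) x (by linarith))).add (hd' (q - 1) x (by linarith))
    refine monotoneOn_of_hasDerivWithinAt_nonneg (convex_Icc 0 1)
      (fun x _ => (hD x).continuousAt.continuousWithinAt)
      (fun x _ => (hD x).hasDerivWithinAt) fun x hx => ?_
    rw [interior_Icc] at hx
    have a := rpow_one_add_le_one_add_mul_self (s := x) (p := q - 1 - 1)
      (by linarith [hx.1]) (by linarith) (by linarith)
    have b := rpow_one_add_le_one_add_mul_self (s := -x) (p := q - 1 - 1)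
      (by linarith [hx.2]) (by linarith) (by linarith)
    rw [← sub_eq_add_neg] at b
    nlinarith
  have h2 : MonotoneOn (fun x : ℝ => q * (q - 1) * x ^ 2 - (1 + x) ^ q - (1 - x) ^ q)
      (Set.Icc 0 1) := by
    have hD (x : ℝ) := (((hasDerivAt_pow 2 x).const_mul (q * (q - 1))).sub
      (hd q x (by linarith))).sub (hd' q x (by linarith))
    refine monotoneOn_of_hasDerivWithinAt_nonneg (convex_Icc 0 1)
      (fun x _ => (hD x).continuousAt.continuousWithinAt)
      (fun x _ => (hD x).hasDerivWithinAt) fun x hx => ?_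
    rw [interior_Icc] at hx
    have a := h1 (Set.left_mem_Icc.2 zero_le_one) ⟨hx.1.le, hx.2.le⟩ hx.1.le
    simp at a
    norm_num
    nlinarith
  have a := h2 (Set.left_mem_Icc.2 zero_le_one) ⟨hy0, hy1⟩ hy0
  norm_num at a
  linarith

lemma abs_add_rpow_add_abs_sub_rpow_le_of_abs_le {q a c : ℝ} (hq2 : 2 ≤ q) (hq3 : q ≤ 3)
    (h : |c| ≤ |a|) :
    (|a + c| ^ q + |a - c| ^ q) / 2 ≤ (a ^ 2 + (q - 1) * c ^ 2) ^ (q / 2) := by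
  wlog ha : 0 ≤ a generalizing a
  · have := this (a := -a) (by simpa using h) (by linarith)
    rw [show -a + c = -(a - c) by ring, show -a - c = -(a + c) by ring, abs_neg, abs_neg,
      neg_sq] at this
    linarith
  wlog hc : 0 ≤ c generalizing c
  · have := this (c := -c) (by simpa using h) (by linarith)
    rw [sub_neg_eq_add, ← sub_eq_add_neg, neg_sq] at this
    linarith
  rw [abs_of_nonneg ha, abs_of_nonneg hc] at h
  rcases ha.eq_or_lt with rfl | ha
  · obtain rfl : c = 0 := le_antisymm h hc
    simp [Real.zero_rpow (show q ≠ 0 by linarith), Real.zero_rpow (show q / 2 ≠ 0 by linarith)]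
  obtain ⟨y, rfl⟩ : ∃ y, c = a * y := ⟨c / a, by field_simp⟩
  have hy0 : 0 ≤ y := nonneg_of_mul_nonneg_right hc ha
  have hy1 : y ≤ 1 := by nlinarith
  have key := one_add_rpow_add_one_sub_rpow_le hq2 hq3 hy0 hy1
  have bern := one_add_mul_self_le_rpow_one_add (s := (q - 1) * y ^ 2) (p := q / 2)
    (by nlinarith [sq_nonneg y]) (by linarith)
  have haq : (a ^ 2) ^ (q / 2) = a ^ q := by
    rw [← Real.rpow_natCast, ← Real.rpow_mul ha.le]
    congr 1
    push_cast
    ring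
  rw [show a + a * y = a * (1 + y) by ring, show a - a * y = a * (1 - y) by ring,
    show a ^ 2 + (q - 1) * (a * y) ^ 2 = a ^ 2 * (1 + (q - 1) * y ^ 2) by ring,
    abs_of_nonneg (mul_nonneg ha.le (by linarith)), abs_of_nonneg (mul_nonneg ha.le (by linarith)),
    Real.mul_rpow ha.le (by linarith), Real.mul_rpow ha.le (by linarith),
    Real.mul_rpow (by positivity) (by nlinarith [sq_nonneg y]), haq]
  have : 0 ≤ a ^ q := by positivity
  nlinarith

/-- The two-point inequality behind `(2, q)`-hypercontractivity, for `2 ≤ q ≤ 3`. -/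
lemma abs_add_rpow_add_abs_sub_rpow_le {q a c : ℝ} (hq2 : 2 ≤ q) (hq3 : q ≤ 3) :
    (|a + c| ^ q + |a - c| ^ q) / 2 ≤ (a ^ 2 + (q - 1) * c ^ 2) ^ (q / 2) := by
  rcases le_total |c| |a| with h | h
  · exact abs_add_rpow_add_abs_sub_rpow_le_of_abs_le hq2 hq3 h
  · have := abs_add_rpow_add_abs_sub_rpow_le_of_abs_le hq2 hq3 h
    rw [add_comm c a, abs_sub_comm c a] at this
    refine this.trans (Real.rpow_le_rpow (by nlinarith [sq_nonneg a, sq_nonneg c]) ?_ (by linarith))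
    nlinarith [sq_le_sq.2 h]

lemma cubeE_mono {n : ℕ} {f g : (Fin n → Bool) → ℝ} (h : ∀ x, f x ≤ g x) :
    cubeE f ≤ cubeE g :=
  div_le_div_of_nonneg_right (Finset.sum_le_sum fun x _ => h x) (by positivity)

lemma cubeE_add_rpow_le {n : ℕ} {p U V : ℝ} (hp : 1 ≤ p) {u v : (Fin n → Bool) → ℝ}
    (hu : ∀ x, 0 ≤ u x) (hv : ∀ x, 0 ≤ v x) (hU : 0 ≤ U) (hV : 0 ≤ V)
    (huU : (cubeE fun x => u x ^ p) ≤ U ^ p) (hvV : (cubeE fun x => v x ^ p) ≤ V ^ p) :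
    (cubeE fun x => (u x + v x) ^ p) ≤ (U + V) ^ p := by
  have hp0 : p ≠ 0 := by linarith
  have h (w : (Fin n → Bool) → ℝ) (W : ℝ) (hw : ∀ x, 0 ≤ w x) (hW : 0 ≤ W)
      (hwW : (cubeE fun x => w x ^ p) ≤ W ^ p) :
      (∑ x, w x ^ p) ^ (1 / p) ≤ ((2 : ℝ) ^ n) ^ (1 / p) * W := by
    rw [cubeE, div_le_iff₀ (by positivity), mul_comm] at hwW
    calc (∑ x, w x ^ p) ^ (1 / p) ≤ ((2 : ℝ) ^ n * W ^ p) ^ (1 / p) :=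
          Real.rpow_le_rpow (Finset.sum_nonneg fun x _ => Real.rpow_nonneg (hw x) p) hwW
            (by positivity)
      _ = _ := by
          rw [Real.mul_rpow (by positivity) (by positivity), one_div,
            Real.rpow_rpow_inv hW hp0]
  have h' := (Real.Lp_add_le_of_nonneg Finset.univ hp (fun x _ => hu x) fun x _ => hv x).trans
    (add_le_add (h u U hu hU huU) (h v V hv hV hvV))
  rw [← mul_add] at h'
  have hs : 0 ≤ ∑ x, (u x + v x) ^ p :=
    Finset.sum_nonneg fun x _ => Real.rpow_nonneg (add_nonneg (hu x) (hv x)) p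
  have h'' := Real.rpow_le_rpow (Real.rpow_nonneg hs _) h' (show 0 ≤ p by linarith)
  rw [one_div, Real.rpow_inv_rpow hs hp0, Real.mul_rpow (by positivity) (by positivity),
    Real.rpow_inv_rpow (by positivity) hp0, mul_comm] at h''
  rwa [cubeE, div_le_iff₀ (by positivity)]

lemma rpow_sq_half {a : ℝ} (q : ℝ) : (a ^ 2) ^ (q / 2) = |a| ^ q := by
  rw [← sq_abs, ← Real.rpow_natCast, ← Real.rpow_mul (abs_nonneg a)]
  congr 1
  push_cast
  ring

/-- The Bonami inequality `E|T_σ h|^q ≤ (E h²)^{q/2}` for `σ² = 1/(q-1)`, `2 ≤ q ≤ 3`. -/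
lemma cubeE_abs_prodNoise_rpow_le {n : ℕ} {q σ : ℝ} (hq2 : 2 ≤ q) (hq3 : q ≤ 3)
    (hσ : (q - 1) * σ ^ 2 = 1) (h : (Fin n → Bool) → ℝ) :
    (cubeE fun x => |prodNoise (fun _ => σ) h x| ^ q) ≤ (cubeE fun x => h x ^ 2) ^ (q / 2) := by
  induction n with
  | zero => simp [cubeE, prodNoise, rpow_sq_half]
  | succ n ih =>
    set A : (Fin n → Bool) → ℝ := fun z =>
      1 / 2 * h (Fin.snoc z true) + 1 / 2 * h (Fin.snoc z false) with hA
    set B : (Fin n → Bool) → ℝ := fun z =>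
      1 / 2 * h (Fin.snoc z true) + -1 / 2 * h (Fin.snoc z false) with hB
    set TA := prodNoise (fun _ => σ) A with hTA
    set TB := prodNoise (fun _ => σ) B with hTB
    have ht (z : Fin n → Bool) : prodNoise (fun _ => σ) h (Fin.snoc z true) =
        TA z + σ * TB z := by
      simp only [hTA, hTB, hA, hB, prodNoise_linear, prodNoise_snoc, Bool.not_true]
      ring
    have hf (z : Fin n → Bool) : prodNoise (fun _ => σ) h (Fin.snoc z false) =
        TA z - σ * TB z := by
      simp only [hTA, hTB, hA, hB, prodNoise_linear, prodNoise_snoc, Bool.not_false]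
      ring
    have hnn (g : (Fin n → Bool) → ℝ) : 0 ≤ cubeE fun z => g z ^ 2 :=
      div_nonneg (Finset.sum_nonneg fun x _ => sq_nonneg _) (by positivity)
    have hE : (cubeE fun x => h x ^ 2) = (cubeE fun z => A z ^ 2) + cubeE fun z => B z ^ 2 := by
      rw [cubeE_succ]
      simp only [cubeE, hA, hB, Fintype.sum_bool, ← add_div, ← Finset.sum_add_distrib]
      rw [div_right_comm, Finset.sum_div]
      exact congrArg (· / _) (Finset.sum_congr rfl fun x _ => by ring)
    rw [hE]
    calc (cubeE fun x => |prodNoise (fun _ => σ) h x| ^ q)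
        = cubeE fun z => (|TA z + σ * TB z| ^ q + |TA z - σ * TB z| ^ q) / 2 := by
          rw [cubeE_succ]
          simp only [Fintype.sum_bool, ht, hf, cubeE, ← add_div, ← Finset.sum_add_distrib]
          rw [div_right_comm, Finset.sum_div]
      _ ≤ cubeE fun z => (TA z ^ 2 + TB z ^ 2) ^ (q / 2) := by
          refine cubeE_mono fun z => ?_
          have := abs_add_rpow_add_abs_sub_rpow_le (a := TA z) (c := σ * TB z) hq2 hq3
          rwa [mul_pow, ← mul_assoc, hσ, one_mul] at this
      _ ≤ _ := by
          refine cubeE_add_rpow_le (by linarith) (fun z => sq_nonneg _) (fun z => sq_nonneg _)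
            (hnn A) (hnn B) ?_ ?_
          · simpa only [rpow_sq_half] using ih A
          · simpa only [rpow_sq_half] using ih B

/-- The indicator of the coordinates with index at least `k`. Noise with these correlations
averages out the coordinates below `k`. -/
def tailInd {n : ℕ} (k : ℕ) (i : Fin n) : ℝ := if k ≤ i then 1 else 0

lemma prodNoise_tailInd_eq_cubeE {n : ℕ} (g : (Fin n → Bool) → ℝ) (x : Fin n → Bool) :
    prodNoise (tailInd n) g x = cubeE g := by
  rw [← prodNoise_zero g x]
  congr 1
  funext i
  simp [tailInd]

lemma prodNoise_tailInd_snoc {n k : ℕ} (hk : k ≤ n) (g : (Fin (n + 1) → Bool) → ℝ)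
    (z : Fin n → Bool) (b : Bool) :
    prodNoise (tailInd k) g (Fin.snoc z b) =
      prodNoise (tailInd k) (fun w => g (Fin.snoc w b)) z := by
  rw [prodNoise_snoc]
  simp [tailInd, hk]
  rfl

/-- `Δ_n` is the sum of the third absolute moments of the increments of the reverse martingale
`E[g | X_k, …, X_n]`. -/
lemma DeltaCube_eq_sum (n : ℕ) (g : (Fin n → Bool) → ℝ) :
    DeltaCube n g = ∑ i : Fin n,
      cubeE fun x => |prodNoise (tailInd i) g x - prodNoise (tailInd (i + 1)) g x| ^ 3 := by
  induction n with
  | zero => simp [DeltaCube]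
  | succ n ih =>
    rw [DeltaCube, Fin.sum_univ_castSucc]
    congr 1
    · simp only [ih, cubeE_succ]
      rw [← Finset.sum_div, Finset.sum_comm]
      congr 1
      refine Finset.sum_congr rfl fun i _ => Finset.sum_congr rfl fun b _ => ?_
      simp only [Fin.val_castSucc, prodNoise_tailInd_snoc (show (i : ℕ) ≤ n by omega),
        prodNoise_tailInd_snoc (show (i : ℕ) + 1 ≤ n by omega)]
    · simp only [Fin.val_last, prodNoise_tailInd_eq_cubeE, Delta1Cube]
      rw [cubeE_succ]
      simp only [prodNoise_tailInd_snoc le_rfl, prodNoise_tailInd_eq_cubeE]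
      rw [← cubeE_succ]
      simp [cubeE]

lemma cubeE_increment_sq {n : ℕ} (f : (Fin n → Bool) → ℝ) (k : ℕ) :
    (cubeE fun x => (prodNoise (tailInd k) f x - prodNoise (tailInd (k + 1)) f x) ^ 2) =
      ∑ S : Finset (Fin n), (∏ i ∈ S, tailInd k i) * fhat f S ^ 2 -
        ∑ S : Finset (Fin n), (∏ i ∈ S, tailInd (k + 1) i) * fhat f S ^ 2 := by
  have h1 (i : Fin n) : tailInd k i * tailInd k i = tailInd k i := by simp [tailInd]
  have h2 (i : Fin n) : tailInd k i * tailInd (k + 1) i = tailInd (k + 1) i := by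
    simp only [tailInd]
    split_ifs <;> first | omega | simp
  have h3 (i : Fin n) : tailInd (k + 1) i * tailInd (k + 1) i = tailInd (k + 1) i := by
    simp [tailInd]
  have e1 := cubeE_prodNoise_mul_prodNoise (tailInd k) (tailInd k) f
  have e2 := cubeE_prodNoise_mul_prodNoise (tailInd k) (tailInd (k + 1)) f
  have e3 := cubeE_prodNoise_mul_prodNoise (tailInd (k + 1)) (tailInd (k + 1)) f
  simp only [h1, h2, h3] at e1 e2 e3
  rw [← e1, ← e2]
  have : (cubeE fun x => prodNoise (tailInd (k + 1)) f x * prodNoise (tailInd (k + 1)) f x) -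
      (cubeE fun x => prodNoise (tailInd k) f x * prodNoise (tailInd (k + 1)) f x) = 0 := by
    rw [e2, e3, sub_self]
  rw [← add_zero (_ - _), ← this]
  simp only [cubeE, ← sub_div, ← add_div, ← Finset.sum_sub_distrib, ← Finset.sum_add_distrib]
  exact congrArg (· / _) (Finset.sum_congr rfl fun x _ => by ring)

lemma prod_tailInd {n : ℕ} (k : ℕ) (S : Finset (Fin n)) :
    ∏ i ∈ S, tailInd k i = if ∀ i ∈ S, k ≤ (i : ℕ) then 1 else 0 := by
  simp only [tailInd, Finset.prod_ite_zero, Finset.prod_const_one]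

lemma cubeE_increment_sq_le_influence {n : ℕ} (f : (Fin n → Bool) → ℝ) (i : Fin n) :
    (cubeE fun x => (prodNoise (tailInd i) f x - prodNoise (tailInd (i + 1)) f x) ^ 2) ≤
      influence f i := by
  rw [cubeE_increment_sq, influence, Finset.powerset_univ, Finset.sum_filter,
    ← Finset.sum_sub_distrib]
  refine Finset.sum_le_sum fun S _ => ?_
  rw [prod_tailInd, prod_tailInd]
  by_cases hi : i ∈ S
  · rw [if_pos hi]
    split_ifs <;> nlinarith [sq_nonneg (fhat f S)]
  · rw [if_neg hi]
    split_ifs with h1 h2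
    · simp
    · refine absurd (fun j hj => ?_) h2
      have : j ≠ i := fun h => hi (h ▸ hj)
      have := h1 j hj
      omega
    · simpa using sq_nonneg (fhat f S)
    · simp

lemma sum_cubeE_increment_sq_le_one {n : ℕ} {f : (Fin n → Bool) → ℝ} (hf : ∀ x, |f x| ≤ 1) :
    (∑ i : Fin n, cubeE fun x =>
      (prodNoise (tailInd i) f x - prodNoise (tailInd (i + 1)) f x) ^ 2) ≤ 1 := by
  simp only [cubeE_increment_sq]
  rw [Fin.sum_univ_eq_sum_range (fun k =>
      ∑ S : Finset (Fin n), (∏ i ∈ S, tailInd k i) * fhat f S ^ 2 -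
        ∑ S : Finset (Fin n), (∏ i ∈ S, tailInd (k + 1) i) * fhat f S ^ 2) n,
    Finset.sum_range_sub']
  have h0 : 0 ≤ ∑ S : Finset (Fin n), (∏ i ∈ S, tailInd n i) * fhat f S ^ 2 :=
    Finset.sum_nonneg fun S _ => by
      rw [prod_tailInd]
      split_ifs <;> positivity
  have h1 : ∑ S : Finset (Fin n), (∏ i ∈ S, tailInd 0 i) * fhat f S ^ 2 ≤ 1 := by
    rw [← cubeE_mul_prodNoise]
    have ht : tailInd 0 = fun _ : Fin n => (1 : ℝ) := by
      funext i
      simp [tailInd]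
    rw [ht, prodNoise_one]
    have h : (cubeE fun x => f x * f x) ≤ cubeE fun _ : Fin n → Bool => (1 : ℝ) :=
      cubeE_mono fun x => by
        rw [← sq]
        exact (sq_le_one_iff_abs_le_one _).2 (hf x)
    simpa [cubeE] using h
  linarith

lemma abs_increment_le_one {n : ℕ} {g : (Fin n → Bool) → ℝ} (hg : ∀ x, |g x| ≤ 1) (i : Fin n)
    (x : Fin n → Bool) :
    |prodNoise (tailInd i) g x - prodNoise (tailInd (i + 1)) g x| ≤ 1 := by
  have hrec : prodNoise (tailInd (i + 1)) g x = (1 / 2) * prodNoise (tailInd i) g x +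
      (1 / 2) * prodNoise (fun j => if j = i then -1 else tailInd i j) g x := by
    simp only [prodNoise, Finset.mul_sum, ← Finset.sum_add_distrib]
    refine Finset.sum_congr rfl fun y _ => ?_
    simp only [← Finset.mul_prod_erase _ _ (Finset.mem_univ i)]
    have h1 : ∏ j ∈ Finset.univ.erase i, (if y j = x j then
        (1 + if j = i then -1 else tailInd i j) / 2
        else (1 - if j = i then -1 else tailInd i j) / 2) =
        ∏ j ∈ Finset.univ.erase i,
          (if y j = x j then (1 + tailInd i j) / 2 else (1 - tailInd i j) / 2 : ℝ) :=
      Finset.prod_congr rfl fun j hj => by rw [if_neg (Finset.ne_of_mem_erase hj)]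
    have h2 : ∏ j ∈ Finset.univ.erase i, (if y j = x j then (1 + tailInd (i + 1) j) / 2
        else (1 - tailInd (i + 1) j) / 2) =
        ∏ j ∈ Finset.univ.erase i,
          (if y j = x j then (1 + tailInd i j) / 2 else (1 - tailInd i j) / 2 : ℝ) :=
      Finset.prod_congr rfl fun j hj => by
        have : tailInd (i + 1) j = tailInd i j := by
          have := Finset.ne_of_mem_erase hj
          have h : (i : ℕ) + 1 ≤ j ↔ (i : ℕ) ≤ j := by omega
          simp only [tailInd, h]
        rw [this]
    rw [h1, h2]
    simp only [tailInd, Nat.not_succ_le_self, le_refl, if_true, if_false]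
    split_ifs <;> ring
  have ht (j : Fin n) : |tailInd (i : ℕ) j| ≤ 1 := by
    simp only [tailInd]
    split_ifs <;> simp
  have a := abs_le.1 (abs_prodNoise_le_one ht hg x)
  have b := abs_le.1 (abs_prodNoise_le_one (ρ := fun j => if j = i then -1 else tailInd i j)
    (fun j => by split_ifs <;> simp [ht]) hg x)
  rw [hrec, abs_le]
  constructor <;> linarith [a.1, a.2, b.1, b.2]

/-- **Claim 5.5**: for `σ` with `1 + σ⁻² ≤ 3` and `f` with values in `[-1,1]`,
`Δ_n(T_σ f) ≤ (max_i Inf_i(f))^{(1-σ²)/(2σ²)}`. -/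
theorem DeltaCube_noiseOp_le (n : ℕ) (hn : 0 < n) (σ : ℝ) (hσ0 : 0 < σ) (hσ1 : σ < 1)
    (hσ2 : 1 + 1 / σ ^ 2 ≤ 3) (f : (Fin n → Bool) → ℝ)
    (hf : ∀ x, f x ∈ Set.Icc (-1 : ℝ) 1) :
    DeltaCube n (noiseOp σ f) ≤
      (⨆ i : Fin n, influence f i) ^ ((1 - σ ^ 2) / (2 * σ ^ 2)) := by
  have hf' (x : Fin n → Bool) : |f x| ≤ 1 := abs_le.2 (hf x)
  obtain ⟨q, hq⟩ : ∃ q : ℝ, q = 1 + 1 / σ ^ 2 := ⟨_, rfl⟩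
  have hσq : (q - 1) * σ ^ 2 = 1 := by
    rw [hq]
    field_simp
    ring
  have hq2 : 2 < q := by
    have : 1 < 1 / σ ^ 2 := one_lt_one_div (by positivity) (by nlinarith)
    linarith
  have hq3 : q ≤ 3 := hq ▸ hσ2
  have hs : (1 - σ ^ 2) / (2 * σ ^ 2) = q / 2 - 1 := by
    rw [hq]
    field_simp
    ring
  rw [hs, DeltaCube_eq_sum]
  set e : Fin n → ℝ := fun i => cubeE fun x =>
    (prodNoise (tailInd i) f x - prodNoise (tailInd (i + 1)) f x) ^ 2 with he
  have he0 (i : Fin n) : 0 ≤ e i :=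
    div_nonneg (Finset.sum_nonneg fun x _ => sq_nonneg _) (by positivity)
  have heM (i : Fin n) : e i ≤ ⨆ i, influence f i :=
    (cubeE_increment_sq_le_influence f i).trans (le_ciSup (Set.finite_range _).bddAbove i)
  have hM : 0 ≤ ⨆ i, influence f i := (he0 ⟨0, hn⟩).trans (heM _)
  have hT : noiseOp σ f = prodNoise (fun _ => σ) f := rfl
  have hTf : ∀ x, |noiseOp σ f x| ≤ 1 := by
    rw [hT]
    exact abs_prodNoise_le_one (fun _ => by rw [abs_of_pos hσ0]; exact hσ1.le) hf'
  have hcomm (k : ℕ) : prodNoise (tailInd k) (noiseOp σ f) =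
      prodNoise (fun _ => σ) (prodNoise (tailInd k) f) := by
    simp only [hT, prodNoise_comp, mul_comm]
  have hterm (i : Fin n) : (cubeE fun x => |prodNoise (tailInd i) (noiseOp σ f) x -
      prodNoise (tailInd (i + 1)) (noiseOp σ f) x| ^ 3) ≤
      e i * (⨆ i, influence f i) ^ (q / 2 - 1) := by
    calc (cubeE fun x => |prodNoise (tailInd i) (noiseOp σ f) x -
          prodNoise (tailInd (i + 1)) (noiseOp σ f) x| ^ 3)
        ≤ cubeE fun x => |prodNoise (tailInd i) (noiseOp σ f) x -
          prodNoise (tailInd (i + 1)) (noiseOp σ f) x| ^ q := by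
          refine cubeE_mono fun x => ?_
          rw [← Real.rpow_natCast]
          exact Real.rpow_le_rpow_of_exponent_ge_of_imp (abs_nonneg _)
            (abs_increment_le_one hTf i x) (by simpa using hq3) (fun _ h => by norm_num at h)
      _ = cubeE fun x => |prodNoise (fun _ => σ) (fun y =>
          1 * prodNoise (tailInd i) f y + (-1) * prodNoise (tailInd (i + 1)) f y) x| ^ q := by
          simp only [prodNoise_linear, hcomm]
          simp only [one_mul, neg_one_mul, ← sub_eq_add_neg]
      _ ≤ e i ^ (q / 2) := by
          refine (cubeE_abs_prodNoise_rpow_le hq2.le hq3 hσq _).trans_eq ?_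
          simp only [he, one_mul, neg_one_mul, ← sub_eq_add_neg]
      _ = e i * e i ^ (q / 2 - 1) := by
          rw [← Real.rpow_one_add' (he0 i) (by linarith)]
          congr 1
          ring
      _ ≤ _ := mul_le_mul_of_nonneg_left
          (Real.rpow_le_rpow (he0 i) (heM i) (by linarith)) (he0 i)
  refine (Finset.sum_le_sum fun i _ => hterm i).trans ?_
  rw [← Finset.sum_mul]
  exact mul_le_of_le_one_left (Real.rpow_nonneg hM _) (sum_cubeE_increment_sq_le_one hf')

end DMN
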